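/- arXiv:1507.08846 — 4 statements merged into one kernel-verified Lean document; each statement's English description precedes it below -/
import Mathlib

section
/- Let λ₁ ≥ 0, ε > 0, and 0 ≤ L < L_max. Then there exists a constant C > 0, depending only on λ₁, ε, and L, with the following property: for all real numbers a, s, h ≥ 0, all μ ≥ max(0, ε − λ₁), and all t ∈ (0,1], if λ₁·s² ≤ a² and a² + μ·s² ≤ t·((λ₁ + μ − ε)·s² + L·a·s + h·s), then s ≤ C·h and a ≤ C·h. In fact one may take s ≤ ρ₀·h with ρ₀ = 4δ₁/(4δ₁ε₂ − L²), where ε₁ = min(ε/2, λ₁), ε₂ = ε − ε₁, and δ₁ = ε₁/λ₁ if λ₁ > 0, δ₁ = 1 if λ₁ = 0. -/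
/-- A quadratic inequality `δ a² + e s² ≤ L a s + h s` with `L² < 4 δ e` bounds `s` linearly
in `h`. -/
theorem le_mul_of_quadratic_le {δ e L a s h : ℝ} (hδ : 0 < δ) (hD : 0 < 4 * δ * e - L ^ 2)
    (hs : 0 ≤ s) (hh : 0 ≤ h) (H : δ * a ^ 2 + e * s ^ 2 ≤ L * a * s + h * s) :
    s ≤ 4 * δ / (4 * δ * e - L ^ 2) * h := by
  rcases hs.eq_or_lt with rfl | hs
  · positivity
  · rw [div_mul_eq_mul_div, le_div_iff₀ hD]
    refine le_of_mul_le_mul_right ?_ hs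
    nlinarith [mul_le_mul_of_nonneg_left H hδ.le, sq_nonneg (2 * δ * a - L * s)]

/-- A quadratic inequality `a² ≤ p h² + q h a` bounds `a` linearly in `h`. -/
theorem le_mul_of_sq_le {p q a h : ℝ} (hp : 0 ≤ p) (hq : 0 ≤ q) (hh : 0 ≤ h)
    (H : a ^ 2 ≤ p * h ^ 2 + q * h * a) : a ≤ (1 + p + q) * h := by
  by_contra! hlt
  have hha : h ≤ a := by nlinarith [mul_nonneg (add_nonneg hp hq) hh]
  have ha : 0 < a := lt_of_le_of_lt (by positivity) hlt
  nlinarith [mul_lt_mul_of_pos_right hlt ha, mul_nonneg hh ha.le,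
    mul_le_mul_of_nonneg_left hha (mul_nonneg hp hh)]

/-- The parameter `μ` and the homotopy parameter `t` can be eliminated. -/
theorem sq_add_mul_sq_le_of_homotopy {lam1 ε L a s h μ t : ℝ} (hL0 : 0 ≤ L) (ha : 0 ≤ a)
    (hs : 0 ≤ s) (hh : 0 ≤ h) (hμ : max 0 (ε - lam1) ≤ μ) (ht : t ∈ Set.Ioc (0 : ℝ) 1)
    (H : a ^ 2 + μ * s ^ 2 ≤ t * ((lam1 + μ - ε) * s ^ 2 + L * a * s + h * s)) :
    a ^ 2 + (ε - lam1) * s ^ 2 ≤ L * a * s + h * s := by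
  have hμ' : 0 ≤ lam1 + μ - ε := by linarith [le_of_max_le_right hμ]
  have hQ : 0 ≤ (lam1 + μ - ε) * s ^ 2 + L * a * s + h * s := by positivity
  linarith [mul_le_of_le_one_left hQ ht.2]

/-- The range and the defining relation of `δ₁`, and the positivity of `4δ₁ε₂ - L²` for
`L < L_max`. -/
theorem delta_properties {lam1 ε L Lmax : ℝ} (hlam1 : 0 ≤ lam1) (hε : 0 < ε) (hL0 : 0 ≤ L)
    (hLmax1 : ε ≤ 2 * lam1 → Lmax = ε / Real.sqrt lam1)
    (hLmax2 : 2 * lam1 ≤ ε → Lmax = 2 * Real.sqrt (ε - lam1))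
    (hL : L < Lmax) {δ : ℝ} (hδ : δ = if 0 < lam1 then min (ε / 2) lam1 / lam1 else 1) :
    0 < δ ∧ δ ≤ 1 ∧ δ * lam1 = min (ε / 2) lam1 ∧
      0 < 4 * δ * (ε - min (ε / 2) lam1) - L ^ 2 := by
  have hsq : L ^ 2 < Lmax ^ 2 := pow_lt_pow_left₀ hL hL0 two_ne_zero
  rcases le_total ε (2 * lam1) with h | h
  · have hpos : 0 < lam1 := by linarith
    rw [hLmax1 h, div_pow, Real.sq_sqrt hlam1] at hsq
    rw [if_pos hpos, min_eq_left (by linarith)] at hδ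
    rw [min_eq_left (by linarith)]
    subst hδ
    refine ⟨by positivity, (div_le_one hpos).2 (by linarith), by field_simp, ?_⟩
    have : 4 * (ε / 2 / lam1) * (ε - ε / 2) = ε ^ 2 / lam1 := by
      field_simp
      ring
    linarith
  · rw [hLmax2 h, mul_pow, Real.sq_sqrt (by linarith)] at hsq
    rw [min_eq_right (by linarith)] at hδ ⊢
    have hδ1 : δ = 1 := by
      rw [hδ]
      split_ifs with hpos
      · exact div_self hpos.ne'
      · rfl
    subst hδ1
    refine ⟨one_pos, le_rfl, one_mul _, by linarith⟩

/-- Numerical core of the a priori `H¹₀` bound (Theorem 2.1 of the paper).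
For `0 ≤ L < L_max` there is a constant `C > 0` depending only on `λ₁, ε, L` such that
whenever `a, s, h ≥ 0`, `μ ≥ max 0 (ε - λ₁)`, `t ∈ (0,1]`, the Poincaré–Steklov inequality
`λ₁ s² ≤ a²` holds and `a² + μ s² ≤ t((λ₁ + μ - ε)s² + L a s + h s)`, then `s ≤ C h` and
`a ≤ C h`; moreover one may take `s ≤ ρ₀ h` with `ρ₀ = 4δ₁/(4δ₁ε₂ - L²)`. -/
theorem apriori_H10_numerical_bound
    (lam1 ε L Lmax : ℝ) (hlam1 : 0 ≤ lam1) (hε : 0 < ε) (hL0 : 0 ≤ L)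
    (hLmax1 : ε ≤ 2 * lam1 → Lmax = ε / Real.sqrt lam1)
    (hLmax2 : 2 * lam1 ≤ ε → Lmax = 2 * Real.sqrt (ε - lam1))
    (hL : L < Lmax) :
    (∃ C : ℝ, 0 < C ∧ ∀ a s h μ t : ℝ,
        0 ≤ a → 0 ≤ s → 0 ≤ h → max 0 (ε - lam1) ≤ μ → t ∈ Set.Ioc (0 : ℝ) 1 →
        lam1 * s ^ 2 ≤ a ^ 2 →
        a ^ 2 + μ * s ^ 2 ≤ t * ((lam1 + μ - ε) * s ^ 2 + L * a * s + h * s) →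
        s ≤ C * h ∧ a ≤ C * h) ∧
    (∀ a s h μ t : ℝ,
        0 ≤ a → 0 ≤ s → 0 ≤ h → max 0 (ε - lam1) ≤ μ → t ∈ Set.Ioc (0 : ℝ) 1 →
        lam1 * s ^ 2 ≤ a ^ 2 →
        a ^ 2 + μ * s ^ 2 ≤ t * ((lam1 + μ - ε) * s ^ 2 + L * a * s + h * s) →
        s ≤ (4 * (if 0 < lam1 then min (ε / 2) lam1 / lam1 else 1) /
          (4 * (if 0 < lam1 then min (ε / 2) lam1 / lam1 else 1) * (ε - min (ε / 2) lam1)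
            - L ^ 2)) * h) := by
  set δ := if 0 < lam1 then min (ε / 2) lam1 / lam1 else 1 with hδ
  obtain ⟨hδ0, hδ1, hδlam, hD⟩ := delta_properties hlam1 hε hL0 hLmax1 hLmax2 hL hδ
  have hbound : ∀ a s h μ t : ℝ,
      0 ≤ a → 0 ≤ s → 0 ≤ h → max 0 (ε - lam1) ≤ μ → t ∈ Set.Ioc (0 : ℝ) 1 →
      lam1 * s ^ 2 ≤ a ^ 2 →
      a ^ 2 + μ * s ^ 2 ≤ t * ((lam1 + μ - ε) * s ^ 2 + L * a * s + h * s) →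
      s ≤ (4 * δ / (4 * δ * (ε - min (ε / 2) lam1) - L ^ 2)) * h := by
    intro a s h μ t ha hs hh hμ ht hP H
    refine le_mul_of_quadratic_le (a := a) hδ0 hD hs hh ?_
    have H' := sq_add_mul_sq_le_of_homotopy hL0 ha hs hh hμ ht H
    rw [← hδlam]
    nlinarith [mul_nonneg (sub_nonneg.2 hδ1) (sub_nonneg.2 hP)]
  refine ⟨?_, hbound⟩
  set ρ := 4 * δ / (4 * δ * (ε - min (ε / 2) lam1) - L ^ 2)
  have hρ : 0 < ρ := div_pos (by positivity) hD
  refine ⟨1 + (lam1 * ρ ^ 2 + ρ) + L * ρ, by positivity, ?_⟩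
  intro a s h μ t ha hs hh hμ ht hP H
  have hsρ := hbound a s h μ t ha hs hh hμ ht hP H
  have H' := sq_add_mul_sq_le_of_homotopy hL0 ha hs hh hμ ht H
  constructor
  · refine hsρ.trans (mul_le_mul_of_nonneg_right ?_ hh)
    have : 0 ≤ lam1 * ρ ^ 2 := by positivity
    have : 0 ≤ L * ρ := by positivity
    linarith
  · refine le_mul_of_sq_le (by positivity) (by positivity) hh ?_
    have h1 : lam1 * s ^ 2 ≤ lam1 * (ρ * h) ^ 2 := by gcongr
    have h2 : L * a * s ≤ L * a * (ρ * h) := by gcongr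
    have h3 : h * s ≤ h * (ρ * h) := by gcongr
    have h4 : 0 ≤ ε * s ^ 2 := by positivity
    linarith
end

section
/- Let λ₁ ≥ 0 and ε > 0, and let L_max be as defined below. Then for all real numbers a, s ≥ 0 with λ₁·s² ≤ a², one has (λ₁ − ε)·s² + L_max·a·s ≤ a². -/
/-- Step (*) in the uniqueness proof: for all `a, s ≥ 0` with `λ₁ s² ≤ a²` one has
`(λ₁ - ε) s² + L_max a s ≤ a²`, where `L_max = ε/√λ₁` if `ε ≤ 2λ₁` (and `λ₁ > 0`) and
`L_max = 2√(ε - λ₁)` if `ε ≥ 2λ₁`. -/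
theorem uniqueness_step_star
    (lam1 ε Lmax : ℝ) (hlam1 : 0 ≤ lam1) (hε : 0 < ε)
    (hLmax1 : ε ≤ 2 * lam1 → Lmax = ε / Real.sqrt lam1)
    (hLmax2 : 2 * lam1 ≤ ε → Lmax = 2 * Real.sqrt (ε - lam1)) :
    ∀ a s : ℝ, 0 ≤ a → 0 ≤ s → lam1 * s ^ 2 ≤ a ^ 2 →
      (lam1 - ε) * s ^ 2 + Lmax * a * s ≤ a ^ 2 := by
  intro a s ha hs h
  rcases le_total ε (2 * lam1) with hle | hle
  · have hpos : 0 < lam1 := by linarith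
    have hr : 0 < Real.sqrt lam1 := Real.sqrt_pos.mpr hpos
    have hsq : Real.sqrt lam1 ^ 2 = lam1 := Real.sq_sqrt hlam1
    rw [hLmax1 hle]
    set r := Real.sqrt lam1
    have hrs : r * s ≤ a := by
      refine abs_le_of_sq_le_sq' ?_ ha |>.2
      rw [mul_pow, hsq]
      exact h
    have hq : ε / r ≤ 2 * r := by
      rw [div_le_iff₀ hr]
      nlinarith
    have hqs : ε / r * s ≤ 2 * r * s := mul_le_mul_of_nonneg_right hq hs
    have hε' : ε = ε / r * r := (div_mul_cancel₀ ε hr.ne').symm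
    have hprod : 0 ≤ (a - r * s) * (a + r * s - ε / r * s) :=
      mul_nonneg (by linarith) (by linarith)
    have hfactor : (a - r * s) * (a + r * s - ε / r * s)
        = a ^ 2 - ((r ^ 2 - ε / r * r) * s ^ 2 + ε / r * a * s) := by ring
    rw [hfactor, hsq, ← hε'] at hprod
    linarith
  · have hsq : Real.sqrt (ε - lam1) ^ 2 = ε - lam1 := Real.sq_sqrt (by linarith)
    rw [hLmax2 hle]
    have hsquare : 0 ≤ (a - Real.sqrt (ε - lam1) * s) ^ 2 := sq_nonneg _
    rw [sub_sq, mul_pow, hsq] at hsquare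
    linarith
end

section
/- Let λ₁ ≥ 0, ε > 0, and 0 ≤ L < L_max. Then for all real numbers a, s ≥ 0, if λ₁·s² ≤ a² and a² ≤ (λ₁ − ε)·s² + L·a·s, then a = 0 and s = 0. -/
/-- Numerical core of the uniqueness proposition: if `0 ≤ L < L_max`, `a, s ≥ 0`,
`λ₁ s² ≤ a²` and `a² ≤ (λ₁ - ε) s² + L a s`, then `a = 0` and `s = 0`.  Here
`L_max = ε/√λ₁` if `ε ≤ 2λ₁` (and `λ₁ > 0`) and `L_max = 2√(ε - λ₁)` if `ε ≥ 2λ₁`. -/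
theorem uniqueness_numerical_core
    (lam1 ε L Lmax : ℝ) (hlam1 : 0 ≤ lam1) (hε : 0 < ε) (hL0 : 0 ≤ L)
    (hLmax1 : ε ≤ 2 * lam1 → Lmax = ε / Real.sqrt lam1)
    (hLmax2 : 2 * lam1 ≤ ε → Lmax = 2 * Real.sqrt (ε - lam1))
    (hL : L < Lmax) :
    ∀ a s : ℝ, 0 ≤ a → 0 ≤ s → lam1 * s ^ 2 ≤ a ^ 2 →
      a ^ 2 ≤ (lam1 - ε) * s ^ 2 + L * a * s → a = 0 ∧ s = 0 := by
  intro a s ha hs h1 h2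
  have hs0 : s = 0 := by
    by_contra hne
    have hspos : 0 < s := lt_of_le_of_ne hs (Ne.symm hne)
    rcases le_total ε (2 * lam1) with h | h
    · have hlam1_pos : 0 < lam1 := by linarith
      have hr : 0 < √lam1 := Real.sqrt_pos.mpr hlam1_pos
      have hr2 : √lam1 ^ 2 = lam1 := Real.sq_sqrt hlam1
      rw [hLmax1 h, lt_div_iff₀ hr] at hL
      set r := √lam1
      have hLr : L < 2 * r := by nlinarith
      have hrs : r * s ≤ a := abs_le_of_sq_le_sq' (by rw [mul_pow, hr2]; exact h1) ha |>.2
      have hlin : 0 ≤ (2 * r - L) * s * (a - r * s) :=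
        mul_nonneg (mul_nonneg (by linarith) hs) (by linarith)
      have hconst : 0 < (ε - L * r) * s ^ 2 := mul_pos (by linarith) (by positivity)
      rw [← hr2] at h2
      nlinarith [sq_nonneg (a - r * s)]
    · have hpos : 0 < ε - lam1 := by linarith
      have hq : 0 < √(ε - lam1) := Real.sqrt_pos.mpr hpos
      have hq2 : √(ε - lam1) ^ 2 = ε - lam1 := Real.sq_sqrt hpos.le
      rw [hLmax2 h] at hL
      set q := √(ε - lam1)
      have hle : a ^ 2 + q ^ 2 * s ^ 2 ≤ L * a * s := by rw [hq2]; linarith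
      rcases ha.eq_or_lt with rfl | hapos
      · have : 0 < q ^ 2 * s ^ 2 := by positivity
        linarith
      · have : 0 < (2 * q - L) * (a * s) := mul_pos (by linarith) (mul_pos hapos hspos)
        nlinarith [sq_nonneg (a - q * s)]
  subst hs0
  exact ⟨pow_eq_zero_iff two_ne_zero |>.mp (by nlinarith [sq_nonneg a]), rfl⟩
end

section
/- Let d ≥ 2 be an integer, let λ₁ ≥ 0, ε > 0, and let r ≥ L_max be a real number. Then there exist vectors b, x ∈ ℝ^d such that |b| = r, the first coordinate x₁ of x belongs to √λ₁ · ℤ, and |x|² − b·x = λ₁ − ε. -/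
open scoped RealInnerProductSpace

/-- Inner product of two vectors supported on the same two coordinates. -/
theorem inner_single_add_single {ι : Type*} [Fintype ι] [DecidableEq ι] {i j : ι} (hij : i ≠ j)
    (p q u v : ℝ) :
    ⟪EuclideanSpace.single i p + EuclideanSpace.single j q,
      EuclideanSpace.single i u + EuclideanSpace.single j v⟫ = p * u + q * v := by
  simp [inner_add_left, EuclideanSpace.inner_single_left, hij, hij.symm]

/-- A planar solution of the norm, lattice and symbol equations embeds in `ℝ^ι`. -/
theorem exists_symbol_zero_of_planar {ι : Type*} [Fintype ι] [DecidableEq ι] {i j : ι}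
    (hij : i ≠ j) {r s c p q u v : ℝ} (hr : 0 ≤ r) (hpq : p * p + q * q = r ^ 2)
    (hu : ∃ k : ℤ, u = s * (k : ℝ)) (huv : u * u + v * v - (p * u + q * v) = c) :
    ∃ b x : EuclideanSpace ℝ ι, ‖b‖ = r ∧ (∃ k : ℤ, x i = s * (k : ℝ)) ∧
      ‖x‖ ^ 2 - ⟪b, x⟫ = c := by
  refine ⟨EuclideanSpace.single i p + EuclideanSpace.single j q,
    EuclideanSpace.single i u + EuclideanSpace.single j v, ?_, ?_, ?_⟩
  · rw [← sq_eq_sq₀ (norm_nonneg _) hr, ← real_inner_self_eq_norm_sq,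
      inner_single_add_single hij, hpq]
  · simpa [hij] using hu
  · rw [← real_inner_self_eq_norm_sq, inner_single_add_single hij,
      inner_single_add_single hij, huv]

/-- Fourier-symbol core of the counterexample: for `d ≥ 2`, `λ₁ ≥ 0`, `ε > 0` and
`r ≥ L_max` there are vectors `b, x ∈ ℝ^d` with `|b| = r`, first coordinate of `x`
in `√λ₁ · ℤ`, and `|x|² - b·x = λ₁ - ε`.  Here `L_max = ε/√λ₁` if `ε ≤ 2λ₁`
(and `λ₁ > 0`) and `L_max = 2√(ε - λ₁)` if `ε ≥ 2λ₁`. -/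
theorem counterexample_symbol_vanishes
    (d : ℕ) (hd : 2 ≤ d) (lam1 ε r Lmax : ℝ) (hlam1 : 0 ≤ lam1) (hε : 0 < ε)
    (hLmax1 : ε ≤ 2 * lam1 → Lmax = ε / Real.sqrt lam1)
    (hLmax2 : 2 * lam1 ≤ ε → Lmax = 2 * Real.sqrt (ε - lam1))
    (hr : Lmax ≤ r) :
    ∃ b x : EuclideanSpace ℝ (Fin d), ‖b‖ = r ∧
      (∃ k : ℤ, x ⟨0, by omega⟩ = Real.sqrt lam1 * (k : ℝ)) ∧
      ‖x‖ ^ 2 - ⟪b, x⟫ = lam1 - ε := by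
  have hij : (⟨0, by omega⟩ : Fin d) ≠ ⟨1, by omega⟩ := by simp
  rcases le_total ε (2 * lam1) with h | h
  · have hL := hLmax1 h
    have hs : 0 < Real.sqrt lam1 := Real.sqrt_pos.2 (by linarith)
    have hL0 : 0 ≤ Lmax := hL ▸ by positivity
    have hLs : Lmax * Real.sqrt lam1 = ε := by rw [hL]; field_simp
    have hq := Real.mul_self_sqrt (show 0 ≤ r ^ 2 - Lmax ^ 2 by nlinarith)
    refine exists_symbol_zero_of_planar hij (p := Lmax) (q := Real.sqrt (r ^ 2 - Lmax ^ 2))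
      (u := Real.sqrt lam1) (v := 0) (hL0.trans hr) (by linarith) ⟨1, by simp⟩ ?_
    rw [hLs, Real.mul_self_sqrt hlam1]
    ring
  · have hL := hLmax2 h
    have hL0 : 0 ≤ Lmax := hL ▸ by positivity
    have ht := Real.mul_self_sqrt (show 0 ≤ ε - lam1 by linarith)
    have hq := Real.mul_self_sqrt (show 0 ≤ r ^ 2 - Lmax ^ 2 by nlinarith)
    refine exists_symbol_zero_of_planar hij (p := Real.sqrt (r ^ 2 - Lmax ^ 2)) (q := Lmax)
      (u := 0) (v := Real.sqrt (ε - lam1)) (hL0.trans hr) (by linarith) ⟨0, by simp⟩ ?_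
    rw [hL]
    linarith
end
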